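/- Let α ∈ (0, 1/2), c > 0, and let (H, A, Z) be the c-orbit on (0, ρ₁(c)). Define W(ρ) = (1/2)ρ²A(ρ)H′(ρ)²(1 − Z(ρ)²) + sin²H(ρ). Then W(ρ) = (A(ρ) − 1 + 2α)/(2α) for all ρ ∈ (0, ρ₁(c)), and W is nonincreasing on (0, ρ₁(c)), strictly decreasing at every point where H′ ≠ 0. -/

import Mathlib

open Real Filter Set Topology Asymptotics MeasureTheory

noncomputable section

/-- The CSS (continuously self-similar) system for `(H, A, Z)` with derivative
function `H'`, on the interval `(0, ρ₁)`, together with the constraint, the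
positivity/range conditions, and the initial conditions at `ρ = 0`:
`H(0) = -π/2`, `H'(0) = c`, `A(0) = 1`, `Z(0) = 0`, `Z'(0) = 1`.  This is the
notion of a `c`-orbit. -/
structure IsCOrbit (α c : ℝ) (H H' A Z : ℝ → ℝ) (ρ₁ : ℝ) : Prop where
  rho1_pos : 0 < ρ₁
  hH : ∀ ρ ∈ Set.Ioo 0 ρ₁, HasDerivAt H (H' ρ) ρ
  hH' : ∀ ρ ∈ Set.Ioo 0 ρ₁, HasDerivAt H'
      (α * (1 + Z ρ ^ 2) * ρ * H' ρ ^ 3 - (2 / ρ) * H' ρ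
        - Real.sin (2 * H ρ) / (A ρ * ρ ^ 2 * (1 - Z ρ ^ 2))) ρ
  hA : ∀ ρ ∈ Set.Ioo 0 ρ₁, HasDerivAt A (-2 * α * ρ * A ρ * H' ρ ^ 2) ρ
  hZ : ∀ ρ ∈ Set.Ioo 0 ρ₁, HasDerivAt Z
      (Z ρ * (1 + α * (1 - Z ρ ^ 2) * ρ ^ 2 * H' ρ ^ 2) / ρ) ρ
  constraint : ∀ ρ ∈ Set.Ioo 0 ρ₁,
      1 - 2 * α - A ρ + 2 * α * Real.sin (H ρ) ^ 2
        + α * A ρ * ρ ^ 2 * H' ρ ^ 2 * (1 - Z ρ ^ 2) = 0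
  hApos : ∀ ρ ∈ Set.Ioo 0 ρ₁, 0 < A ρ
  hZ01 : ∀ ρ ∈ Set.Ioo 0 ρ₁, 0 ≤ Z ρ ∧ Z ρ < 1
  H0 : H 0 = -(π / 2)
  A0 : A 0 = 1
  Z0 : Z 0 = 0
  Hcont : Tendsto H (𝓝[>] 0) (𝓝 (-(π / 2)))
  H'init : Tendsto H' (𝓝[>] 0) (𝓝 c)
  Acont : Tendsto A (𝓝[>] 0) (𝓝 1)
  Zcont : Tendsto Z (𝓝[>] 0) (𝓝 0)
  Z'init : Tendsto (fun ρ => Z ρ / ρ) (𝓝[>] 0) (𝓝 1)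

/-- Properties of the energy-like function
`W = (1/2) ρ² A H'² (1 - Z²) + sin²H` along a `c`-orbit: `W` coincides with
`(A - 1 + 2α)/(2α)`, is nonincreasing on `(0, ρ₁(c))` (with derivative
`-ρ A H'²`), and is strictly decreasing near every point where `H' ≠ 0`. -/
theorem W_monotone (α : ℝ) (hα0 : 0 < α) (hα : α < 1 / 2)
    (c : ℝ) (hc : 0 < c) (H H' A Z : ℝ → ℝ) (ρ₁ : ℝ)
    (horb : IsCOrbit α c H H' A Z ρ₁)
    (W : ℝ → ℝ)
    (hW : ∀ ρ, W ρ = (1 / 2) * ρ ^ 2 * A ρ * H' ρ ^ 2 * (1 - Z ρ ^ 2)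
        + Real.sin (H ρ) ^ 2) :
    (∀ ρ ∈ Set.Ioo 0 ρ₁, W ρ = (A ρ - 1 + 2 * α) / (2 * α)) ∧
    (∀ ρ ∈ Set.Ioo 0 ρ₁, HasDerivAt W (-(ρ * A ρ * H' ρ ^ 2)) ρ) ∧
    AntitoneOn W (Set.Ioo 0 ρ₁) ∧
    (∀ ρ ∈ Set.Ioo 0 ρ₁, H' ρ ≠ 0 →
      ∃ ε > 0, StrictAntiOn W (Set.Ioo (ρ - ε) (ρ + ε) ∩ Set.Ioo 0 ρ₁)) := by
  have hWA : ∀ ρ ∈ Set.Ioo 0 ρ₁, W ρ = (A ρ - 1 + 2 * α) / (2 * α) := by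
    intro ρ hρ
    rw [hW, eq_div_iff (by positivity)]
    linear_combination horb.constraint ρ hρ
  have hderiv : ∀ ρ ∈ Set.Ioo 0 ρ₁, HasDerivAt W (-(ρ * A ρ * H' ρ ^ 2)) ρ := by
    intro ρ hρ
    have h := (((horb.hA ρ hρ).sub_const 1).add_const (2 * α)).div_const (2 * α)
    have hval : -2 * α * ρ * A ρ * H' ρ ^ 2 / (2 * α) = -(ρ * A ρ * H' ρ ^ 2) := by
      field_simp
    rw [hval] at h
    exact h.congr_of_eventuallyEq
      (Filter.eventually_of_mem (isOpen_Ioo.mem_nhds hρ) hWA)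
  refine ⟨hWA, hderiv, ?_, ?_⟩
  · refine antitoneOn_of_deriv_nonpos (convex_Ioo 0 ρ₁)
      (fun x hx => (hderiv x hx).continuousAt.continuousWithinAt) ?_ ?_
    · rw [interior_Ioo]
      exact fun x hx => (hderiv x hx).differentiableAt.differentiableWithinAt
    · rw [interior_Ioo]
      intro x hx
      rw [(hderiv x hx).deriv, neg_nonpos]
      have := hx.1
      have := horb.hApos x hx
      positivity
  · intro ρ hρ hne
    obtain ⟨ε, hε, hball⟩ := Metric.eventually_nhds_iff_ball.mp
      ((horb.hH' ρ hρ).continuousAt.eventually_ne hne)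
    rw [Real.ball_eq_Ioo] at hball
    refine ⟨ε, hε, strictAntiOn_of_deriv_neg ((convex_Ioo _ _).inter (convex_Ioo _ _))
      (fun x hx => (hderiv x hx.2).continuousAt.continuousWithinAt) ?_⟩
    intro x hx
    obtain ⟨hxε, hx⟩ := interior_subset hx
    rw [(hderiv x hx).deriv, neg_lt_zero]
    have := hx.1
    have := horb.hApos x hx
    have := hball x hxε
    positivity
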